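/- Let Ax ⊆ L⇛ be consistent, Σ ⊆ L⇛ contain ⊤ and be closed under subformulas, Γ a prime (Ax,Σ)-theory and φ ∈ Σ, and define U_{Γ,φ} := {Δ ∈ Th_{Ax,Σ} | for all ψ ∈ Σ, Γ ⊢_Ax φ⇛ψ implies ψ ∈ Δ}. Then: (1) (Γ, U_{Γ,φ}) is an (Ax,Σ)-segment; (2) φ ∈ Δ for all Δ ∈ U_{Γ,φ}; (3) if θ ∈ Σ and Γ ⊬_Ax φ⇛θ, then there exists Δ ∈ U_{Γ,φ} with θ ∉ Δ. -/

import Mathlib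

/-- Formulas of the language `L⇛`. -/
inductive Fml : Type where
  | var : Nat → Fml
  | top : Fml
  | bot : Fml
  | and : Fml → Fml → Fml
  | or  : Fml → Fml → Fml
  | imp : Fml → Fml → Fml
  | sto : Fml → Fml → Fml
deriving DecidableEq

/-- Uniform substitution. -/
def Fml.subst (σ : Nat → Fml) : Fml → Fml
  | .var p => σ p
  | .top => .top
  | .bot => .bot
  | .and φ ψ => .and (φ.subst σ) (ψ.subst σ)
  | .or φ ψ => .or (φ.subst σ) (ψ.subst σ)
  | .imp φ ψ => .imp (φ.subst σ) (ψ.subst σ)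
  | .sto φ ψ => .sto (φ.subst σ) (ψ.subst σ)

/-- Conjunction `φ₁ ∧ ⋯ ∧ φₙ` of a list of formulas (`⊤` for the empty list). -/
def Fml.conj : List Fml → Fml
  | [] => .top
  | [φ] => φ
  | φ :: ψ :: rest => .and φ (Fml.conj (ψ :: rest))

/-- Disjunction `φ₁ ∨ ⋯ ∨ φₙ` of a list of formulas (`⊥` for the empty list). -/
def Fml.disj : List Fml → Fml
  | [] => .bot
  | [φ] => φ
  | φ :: ψ :: rest => .or φ (Fml.disj (ψ :: rest))

/-- Axiom schemes of intuitionistic propositional logic (a standard Hilbert-style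
axiomatisation); as schemes, they comprise all substitution instances. -/
inductive IpcAx : Fml → Prop where
  | k (φ ψ : Fml) : IpcAx (.imp φ (.imp ψ φ))
  | s (φ ψ χ : Fml) : IpcAx (.imp (.imp φ (.imp ψ χ)) (.imp (.imp φ ψ) (.imp φ χ)))
  | andE1 (φ ψ : Fml) : IpcAx (.imp (.and φ ψ) φ)
  | andE2 (φ ψ : Fml) : IpcAx (.imp (.and φ ψ) ψ)
  | andI (φ ψ : Fml) : IpcAx (.imp φ (.imp ψ (.and φ ψ)))
  | orI1 (φ ψ : Fml) : IpcAx (.imp φ (.or φ ψ))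
  | orI2 (φ ψ : Fml) : IpcAx (.imp ψ (.or φ ψ))
  | orE (φ ψ χ : Fml) : IpcAx (.imp (.imp φ χ) (.imp (.imp ψ χ) (.imp (.or φ ψ) χ)))
  | botE (φ : Fml) : IpcAx (.imp .bot φ)
  | top : IpcAx .top

/-- Substitution instances of the axioms of intuitionistic logic together with
`k_a : ((p⇛q)∧(p⇛r))→(p⇛(q∧r))` and `tr : ((p⇛q)∧(q⇛r))→(p⇛r)`. -/
inductive BaseAx : Fml → Prop where
  | ipc {φ : Fml} : IpcAx φ → BaseAx φ
  | ka (φ ψ χ : Fml) : BaseAx (.imp (.and (.sto φ ψ) (.sto φ χ)) (.sto φ (.and ψ χ)))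
  | tr (φ ψ χ : Fml) : BaseAx (.imp (.and (.sto φ ψ) (.sto ψ χ)) (.sto φ χ))

/-- Derivability of the consecution `Γ ⇒ φ` in `HLC♭ ⊕ Ax`, i.e. `Γ ⊢_Ax φ`. -/
inductive Deriv (Ax : Set Fml) : Set Fml → Fml → Prop where
  | base {Γ : Set Fml} {φ : Fml} : BaseAx φ → Deriv Ax Γ φ
  | axm {Γ : Set Fml} {ψ : Fml} (σ : Nat → Fml) : ψ ∈ Ax → Deriv Ax Γ (ψ.subst σ)
  | el {Γ : Set Fml} {φ : Fml} : φ ∈ Γ → Deriv Ax Γ φ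
  | mp {Γ : Set Fml} {φ ψ : Fml} : Deriv Ax Γ φ → Deriv Ax Γ (.imp φ ψ) → Deriv Ax Γ ψ
  | na {Γ : Set Fml} {φ ψ : Fml} : Deriv Ax (∅ : Set Fml) (.imp φ ψ) → Deriv Ax Γ (.sto φ ψ)

/-- `Γ ⊢_Ax Δ`: there are `ψ₁, …, ψₘ ∈ Δ` (m ≥ 1) with `Γ ⊢_Ax ψ₁ ∨ ⋯ ∨ ψₘ`. -/
def DerivDisj (Ax Γ Δ : Set Fml) : Prop :=
  ∃ L : List Fml, L ≠ [] ∧ (∀ ψ ∈ L, ψ ∈ Δ) ∧ Deriv Ax Γ (Fml.disj L)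

/-- A set of axioms is consistent if it does not derive `⊥`. -/
def Consistent (Ax : Set Fml) : Prop := ¬ Deriv Ax (∅ : Set Fml) .bot

/-- A prime `Ax`-theory: deductively closed, consistent, and prime. -/
def IsPrimeTheory (Ax Γ : Set Fml) : Prop :=
  (∀ φ, Deriv Ax Γ φ → φ ∈ Γ) ∧
  ¬ Deriv Ax Γ .bot ∧
  (∀ L : List Fml, L ≠ [] → Deriv Ax Γ (Fml.disj L) → ∃ φ ∈ L, φ ∈ Γ)

/-- `S` is closed under subformulas. -/
def SubfClosed (S : Set Fml) : Prop :=
  (∀ φ ψ : Fml, Fml.and φ ψ ∈ S → φ ∈ S ∧ ψ ∈ S) ∧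
  (∀ φ ψ : Fml, Fml.or φ ψ ∈ S → φ ∈ S ∧ ψ ∈ S) ∧
  (∀ φ ψ : Fml, Fml.imp φ ψ ∈ S → φ ∈ S ∧ ψ ∈ S) ∧
  (∀ φ ψ : Fml, Fml.sto φ ψ ∈ S → φ ∈ S ∧ ψ ∈ S)

/-- A prime `(Ax,S)`-theory: a subset of `S` that is deductively closed within `S`,
consistent, and `S`-prime. -/
def PrimeTheoryIn (Ax S Γ : Set Fml) : Prop :=
  Γ ⊆ S ∧
  (∀ φ ∈ S, Deriv Ax Γ φ → φ ∈ Γ) ∧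
  ¬ Deriv Ax Γ .bot ∧
  (∀ L : List Fml, L ≠ [] → (∀ ψ ∈ L, ψ ∈ S) → Deriv Ax Γ (Fml.disj L) →
    ∃ φ ∈ L, φ ∈ Γ)

/-- `(Γ, U)` is an `(Ax,S)`-segment: `Γ` and all members of `U` are prime
`(Ax,S)`-theories, `U` is closed upwards under inclusion among prime
`(Ax,S)`-theories (S1), and for all `φ, ψ ∈ S`, if `Γ ⊢_Ax φ⇛ψ` and `φ` belongs to
every member of `U`, then so does `ψ` (S2). -/
def IsSegment (Ax S : Set Fml) (Γ : Set Fml) (U : Set (Set Fml)) : Prop :=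
  PrimeTheoryIn Ax S Γ ∧
  (∀ Δ ∈ U, PrimeTheoryIn Ax S Δ) ∧
  (∀ Δ ∈ U, ∀ Δ', PrimeTheoryIn Ax S Δ' → Δ ⊆ Δ' → Δ' ∈ U) ∧
  (∀ φ ψ : Fml, φ ∈ S → ψ ∈ S → Deriv Ax Γ (.sto φ ψ) →
    (∀ Δ ∈ U, φ ∈ Δ) → ∀ Δ ∈ U, ψ ∈ Δ)

/-- The type of `(Ax,S)`-segments. -/
def Segment (Ax S : Set Fml) : Type :=
  {p : Set Fml × Set (Set Fml) // IsSegment Ax S p.1 p.2}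

/-- Truth at a segment `(Γ,U)` of the full canonical model `M_{Ax,S}`:
`(Γ,U) ≼ (Γ',U')` iff `Γ ⊆ Γ'`, `(Γ,U) R (Γ',U')` iff `Γ' ∈ U`, and
`V(p) = {(Γ,U) | p ∈ Γ}`. -/
def canonSat (Ax S : Set Fml) : Fml → Segment Ax S → Prop
  | .var p, w => Fml.var p ∈ w.1.1
  | .top, _ => True
  | .bot, _ => False
  | .and φ ψ, w => canonSat Ax S φ w ∧ canonSat Ax S ψ w
  | .or φ ψ, w => canonSat Ax S φ w ∨ canonSat Ax S ψ w
  | .imp φ ψ, w => ∀ v : Segment Ax S, w.1.1 ⊆ v.1.1 →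
      canonSat Ax S φ v → canonSat Ax S ψ v
  | .sto φ ψ, w => ∀ w' : Segment Ax S, w.1.1 ⊆ w'.1.1 →
      (∀ v : Segment Ax S, v.1.1 ∈ w'.1.2 → canonSat Ax S φ v) →
      ∀ v : Segment Ax S, v.1.1 ∈ w'.1.2 → canonSat Ax S ψ v

/-- The single negation `∼φ`: `ψ` if `φ = ¬ψ`, and `¬φ` otherwise. -/
def Fml.sneg : Fml → Fml
  | .imp ψ .bot => ψ
  | φ => .imp φ .bot

/-- `S` is closed under single negations. -/
def SnClosed (S : Set Fml) : Prop := ∀ φ ∈ S, Fml.sneg φ ∈ S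

/-- The set `U_{Γ,φ} := {Δ ∈ Th_{Ax,S} | ∀ ψ ∈ S, Γ ⊢_Ax φ⇛ψ → ψ ∈ Δ}`. -/
def segU (Ax S Γ : Set Fml) (φ : Fml) : Set (Set Fml) :=
  {Δ | PrimeTheoryIn Ax S Δ ∧ ∀ ψ ∈ S, Deriv Ax Γ (.sto φ ψ) → ψ ∈ Δ}

namespace Deriv

variable {Ax : Set Fml}

theorem ipc {Γ : Set Fml} {φ : Fml} (h : IpcAx φ) : Deriv Ax Γ φ := base (.ipc h)

theorem mono {Γ Δ : Set Fml} {φ : Fml} (h : Deriv Ax Γ φ) (hsub : Γ ⊆ Δ) : Deriv Ax Δ φ := by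
  induction h with
  | base h => exact base h
  | axm σ h => exact axm σ h
  | el h => exact el (hsub h)
  | mp _ _ ih₁ ih₂ => exact mp (ih₁ hsub) (ih₂ hsub)
  | na h _ => exact na h

theorem imp_intro {Γ : Set Fml} {φ : Fml} (ψ : Fml) (h : Deriv Ax Γ φ) :
    Deriv Ax Γ (.imp ψ φ) :=
  mp h (ipc (.k φ ψ))

theorem imp_refl (Γ : Set Fml) (φ : Fml) : Deriv Ax Γ (.imp φ φ) :=
  mp (ipc (.k φ φ)) (mp (ipc (.k φ (.imp φ φ))) (ipc (.s φ (.imp φ φ) φ)))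

theorem imp_mp {Γ : Set Fml} {α φ ψ : Fml} (h₁ : Deriv Ax Γ (.imp α φ))
    (h₂ : Deriv Ax Γ (.imp α (.imp φ ψ))) : Deriv Ax Γ (.imp α ψ) :=
  mp h₁ (mp h₂ (ipc (.s α φ ψ)))

theorem and_intro {Γ : Set Fml} {φ ψ : Fml} (h₁ : Deriv Ax Γ φ) (h₂ : Deriv Ax Γ ψ) :
    Deriv Ax Γ (.and φ ψ) :=
  mp h₂ (mp h₁ (ipc (.andI φ ψ)))

/-- The deduction theorem. -/
theorem deduction {Γ : Set Fml} {α φ : Fml} (h : Deriv Ax (insert α Γ) φ) :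
    Deriv Ax Γ (.imp α φ) := by
  generalize hX : insert α Γ = X at h
  induction h with
  | base h => exact imp_intro _ (base h)
  | axm σ h => exact imp_intro _ (axm σ h)
  | el h =>
    subst hX
    rcases h with rfl | h
    · exact imp_refl _ _
    · exact imp_intro _ (el h)
  | mp _ _ ih₁ ih₂ => exact imp_mp (ih₁ hX) (ih₂ hX)
  | na h _ => exact imp_intro _ (na h)

theorem sto_trans {Γ : Set Fml} {φ ψ χ : Fml} (h₁ : Deriv Ax Γ (.sto φ ψ))
    (h₂ : Deriv Ax Γ (.sto ψ χ)) : Deriv Ax Γ (.sto φ χ) :=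
  mp (and_intro h₁ h₂) (base (.tr φ ψ χ))

/-- The consequents of a fixed antecedent of `⇛` form a deductively closed set. -/
theorem sto_of_deriv {Γ : Set Fml} {φ θ : Fml}
    (h : Deriv Ax {χ | Deriv Ax Γ (.sto φ χ)} θ) : Deriv Ax Γ (.sto φ θ) := by
  generalize hX : {χ | Deriv Ax Γ (.sto φ χ)} = X at h
  induction h with
  | base h => exact na (imp_intro _ (base h))
  | axm σ h => exact na (imp_intro _ (axm σ h))
  | el h => subst hX; exact h
  | @mp _ χ ψ _ _ ih₁ ih₂ =>
    have h := mp (and_intro (ih₁ hX) (ih₂ hX)) (base (.ka φ χ (.imp χ ψ)))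
    exact sto_trans h (na (imp_mp (ipc (.andE1 _ _)) (ipc (.andE2 _ _))))
  | na h _ => exact na (imp_intro _ (na h))

theorem exists_of_sUnion {c : Set (Set Fml)} (hc : IsChain (· ⊆ ·) c) (hne : c.Nonempty)
    {φ : Fml} (h : Deriv Ax (⋃₀ c) φ) : ∃ Γ ∈ c, Deriv Ax Γ φ := by
  generalize hX : ⋃₀ c = X at h
  obtain ⟨Γ₀, hΓ₀⟩ := hne
  induction h with
  | base h => exact ⟨Γ₀, hΓ₀, base h⟩
  | axm σ h => exact ⟨Γ₀, hΓ₀, axm σ h⟩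
  | el h =>
    subst hX
    obtain ⟨Γ, hΓ, hφ⟩ := h
    exact ⟨Γ, hΓ, el hφ⟩
  | mp _ _ ih₁ ih₂ =>
    obtain ⟨Γ₁, hΓ₁, h₁⟩ := ih₁ hX
    obtain ⟨Γ₂, hΓ₂, h₂⟩ := ih₂ hX
    rcases hc.total hΓ₁ hΓ₂ with hle | hle
    · exact ⟨Γ₂, hΓ₂, mp (h₁.mono hle) h₂⟩
    · exact ⟨Γ₁, hΓ₁, mp h₁ (h₂.mono hle)⟩
  | na h _ => exact ⟨Γ₀, hΓ₀, na h⟩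

theorem imp_of_disj {Γ : Set Fml} {θ : Fml} :
    ∀ L : List Fml, (∀ ψ ∈ L, Deriv Ax Γ (.imp ψ θ)) → Deriv Ax Γ (.imp (Fml.disj L) θ)
  | [], _ => ipc (.botE θ)
  | [φ], h => h φ (by simp)
  | φ :: ψ :: L, h =>
    mp (imp_of_disj (ψ :: L) fun χ hχ => h χ (List.mem_cons_of_mem _ hχ))
      (mp (h φ List.mem_cons_self) (ipc (.orE _ _ _)))

end Deriv

/-- Lindenbaum's lemma: a set not deriving `θ` extends to a prime theory omitting `θ`. -/
theorem exists_isPrimeTheory_of_not_deriv {Ax T : Set Fml} {θ : Fml} (h : ¬ Deriv Ax T θ) :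
    ∃ P, T ⊆ P ∧ IsPrimeTheory Ax P ∧ θ ∉ P := by
  obtain ⟨P, hTP, hP⟩ := zorn_subset_nonempty {X | ¬ Deriv Ax X θ}
    (fun c hc hchain hne => ⟨⋃₀ c, fun hd => by
      obtain ⟨X, hX, hd⟩ := Deriv.exists_of_sUnion hchain hne hd
      exact hc hX hd, fun X hX => Set.subset_sUnion_of_mem hX⟩) T h
  have hθ : ¬ Deriv Ax P θ := hP.prop
  have himp : ∀ ψ ∉ P, Deriv Ax P (.imp ψ θ) := fun ψ hψ => by
    by_contra hn
    exact hψ (hP.le_of_ge (y := insert ψ P) (fun hd => hn hd.deduction) (Set.subset_insert _ _)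
      (Set.mem_insert _ _))
  refine ⟨P, hTP, ⟨fun ψ hψ => ?_, fun hbot => hθ (.mp hbot (.ipc (.botE θ))),
    fun L _ hL => ?_⟩, fun hmem => hθ (.el hmem)⟩
  · by_contra hn
    exact hθ (.mp hψ (himp ψ hn))
  · by_contra! hn
    exact hθ (.mp hL (Deriv.imp_of_disj L fun ψ hψ => himp ψ (hn ψ hψ)))

theorem IsPrimeTheory.primeTheoryIn_inter {Ax P : Set Fml} (hP : IsPrimeTheory Ax P)
    (S : Set Fml) : PrimeTheoryIn Ax S (P ∩ S) := by
  obtain ⟨hclosed, hcons, hprime⟩ := hP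
  refine ⟨Set.inter_subset_right, fun φ hφ hd => ⟨hclosed φ (hd.mono Set.inter_subset_left), hφ⟩,
    fun hd => hcons (hd.mono Set.inter_subset_left), fun L hL hLS hd => ?_⟩
  obtain ⟨φ, hφL, hφP⟩ := hprime L hL (hd.mono Set.inter_subset_left)
  exact ⟨φ, hφL, hφP, hLS φ hφL⟩

theorem exists_mem_segU_notMem {Ax Γ : Set Fml} (S : Set Fml) {φ θ : Fml}
    (h : ¬ Deriv Ax Γ (.sto φ θ)) : ∃ Δ ∈ segU Ax S Γ φ, θ ∉ Δ := by
  obtain ⟨P, hTP, hP, hθ⟩ := exists_isPrimeTheory_of_not_deriv (mt Deriv.sto_of_deriv h)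
  exact ⟨P ∩ S, ⟨hP.primeTheoryIn_inter S, fun ψ hψ hd => ⟨hTP hd, hψ⟩⟩, fun hmem => hθ hmem.1⟩

/-- `(Γ, U_{Γ,φ})` is an `(Ax,Σ)`-segment, `φ` belongs to every
member of `U_{Γ,φ}`, and if `Γ ⊬_Ax φ⇛θ` for `θ ∈ Σ`, then some member of
`U_{Γ,φ}` omits `θ`. -/
theorem segment_helper (Ax S : Set Fml) (hcon : Consistent Ax)
    (htop : Fml.top ∈ S) (hsub : SubfClosed S)
    (Γ : Set Fml) (hΓ : PrimeTheoryIn Ax S Γ) (φ : Fml) (hφ : φ ∈ S) :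
    IsSegment Ax S Γ (segU Ax S Γ φ) ∧
    (∀ Δ ∈ segU Ax S Γ φ, φ ∈ Δ) ∧
    (∀ θ ∈ S, ¬ Deriv Ax Γ (.sto φ θ) → ∃ Δ ∈ segU Ax S Γ φ, θ ∉ Δ) := by
  refine ⟨⟨hΓ, fun Δ hΔ => hΔ.1, ?_, ?_⟩, ?_, fun θ _ h => exists_mem_segU_notMem S h⟩
  · exact fun Δ hΔ Δ' hΔ' hle => ⟨hΔ', fun ψ hψ hd => hle (hΔ.2 ψ hψ hd)⟩
  · intro ψ χ _ hχ hd hall Δ hΔ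
    refine hΔ.2 χ hχ (Deriv.sto_trans ?_ hd)
    by_contra hn
    obtain ⟨Δ', hΔ', hψ⟩ := exists_mem_segU_notMem S hn
    exact hψ (hall Δ' hΔ')
  · exact fun Δ hΔ => hΔ.2 φ hφ (.na (Deriv.imp_refl ∅ φ))
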